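/- Let q ≡ 3 (mod 4) be an odd prime power and j ∈ F_q with j² + j ≠ 0. In PSL(2,q) acting on unordered pairs of distinct projective points, let H be the stabilizer of {0, ∞} (a dihedral group of order q-1). Then the H-orbit of the pair {j, j+1} has length (q-1)/2 if j² + j is a non-square, and length q - 1 if j² + j is a nonzero square. -/

import Mathlib

open Matrix Projectivization MulAction Pointwise

variable {F : Type*} [Field F]

/-- The natural action of `SL(2,F)` on the projective line `ℙ F (F²)`. Since the center
`{±1}` acts trivially, orbits and transitivity statements for subgroups of `PSL(2,F)`
coincide with those for their preimages in `SL(2,F)`. -/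
instance slProjAction : MulAction (Matrix.SpecialLinearGroup (Fin 2) F) (Projectivization F (Fin 2 → F)) where
  smul g x := Projectivization.map (Matrix.SpecialLinearGroup.toLin' g).toLinearMap
      (Matrix.SpecialLinearGroup.toLin' g).injective x
  one_smul x := by
    induction x using Projectivization.ind with
    | h v hv =>
      show Projectivization.map _ _ _ = _
      rw [Projectivization.map_mk]
      exact (Projectivization.mk_eq_mk_iff F _ _ _ hv).2 ⟨1, by simp⟩
  mul_smul g h x := by
    induction x using Projectivization.ind with
    | h v hv =>
      show Projectivization.map _ _ _ = Projectivization.map _ _ (Projectivization.map _ _ _)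
      rw [Projectivization.map_mk, Projectivization.map_mk, Projectivization.map_mk]
      exact (Projectivization.mk_eq_mk_iff F _ _ _ _).2 ⟨1, by simp [_root_.map_mul]⟩

/-- The projective point `⟨(1, j)⟩`, representing `j ∈ F` on the projective line. -/
def projPt (j : F) : Projectivization F (Fin 2 → F) :=
  Projectivization.mk F ![1, j] (by
    intro h
    have h0 := congrFun h 0
    simp at h0)

/-- The projective point `⟨(0, 1)⟩`, representing `∞` on the projective line. -/
def projInf : Projectivization F (Fin 2 → F) :=
  Projectivization.mk F ![0, 1] (by
    intro h
    have h1 := congrFun h 1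
    simp at h1)

theorem mk_eq_projPt_iff (v : Fin 2 → F) (hv : v ≠ 0) (x : F) :
    Projectivization.mk F v hv = projPt x ↔ v 1 = x * v 0 := by
  rw [projPt, Projectivization.mk_eq_mk_iff']
  constructor
  · rintro ⟨a, rfl⟩
    simp [mul_comm]
  · intro h
    refine ⟨v 0, ?_⟩
    ext i
    fin_cases i <;> simp [h, mul_comm]

theorem mk_eq_projInf_iff (v : Fin 2 → F) (hv : v ≠ 0) :
    Projectivization.mk F v hv = projInf ↔ v 0 = 0 := by
  rw [projInf, Projectivization.mk_eq_mk_iff']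
  constructor
  · rintro ⟨a, rfl⟩
    simp
  · intro h
    refine ⟨v 1, ?_⟩
    ext i
    fin_cases i <;> simp [h]

theorem projPt_injective : Function.Injective (projPt : F → Projectivization F (Fin 2 → F)) := by
  intro x y h
  rw [projPt, mk_eq_projPt_iff] at h
  simpa using h

theorem smul_projPt_eq_projPt_iff (g : Matrix.SpecialLinearGroup (Fin 2) F) (x y : F) :
    g • projPt x = projPt y ↔ g 1 0 + g 1 1 * x = y * (g 0 0 + g 0 1 * x) := by
  change Projectivization.map _ _ (projPt x) = _ ↔ _
  rw [projPt, Projectivization.map_mk, mk_eq_projPt_iff]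
  simp [Matrix.SpecialLinearGroup.toLin'_apply, Matrix.mulVec, dotProduct, Fin.sum_univ_two]

theorem smul_projPt_eq_projInf_iff (g : Matrix.SpecialLinearGroup (Fin 2) F) (x : F) :
    g • projPt x = projInf ↔ g 0 0 + g 0 1 * x = 0 := by
  change Projectivization.map _ _ (projPt x) = _ ↔ _
  rw [projPt, Projectivization.map_mk, mk_eq_projInf_iff]
  simp [Matrix.SpecialLinearGroup.toLin'_apply, Matrix.mulVec, dotProduct, Fin.sum_univ_two]

theorem smul_projInf_eq_projPt_iff (g : Matrix.SpecialLinearGroup (Fin 2) F) (y : F) :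
    g • projInf = projPt y ↔ g 1 1 = y * g 0 1 := by
  change Projectivization.map _ _ projInf = _ ↔ _
  rw [projInf, Projectivization.map_mk, mk_eq_projPt_iff]
  simp [Matrix.SpecialLinearGroup.toLin'_apply, Matrix.mulVec, dotProduct, Fin.sum_univ_two]

theorem smul_projInf_eq_projInf_iff (g : Matrix.SpecialLinearGroup (Fin 2) F) :
    g • (projInf : Projectivization F (Fin 2 → F)) = projInf ↔ g 0 1 = 0 := by
  change Projectivization.map _ _ (Projectivization.mk F ![0, 1] _) = _ ↔ _
  rw [Projectivization.map_mk, mk_eq_projInf_iff]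
  simp [Matrix.SpecialLinearGroup.toLin'_apply, Matrix.mulVec, dotProduct, Fin.sum_univ_two]

theorem smul_pair {G X : Type*} [Group G] [MulAction G X] (g : G) (x y : X) :
    g • ({x, y} : Set X) = {g • x, g • y} := by
  rw [← Set.image_smul, Set.image_pair]

/-- The stabilizer of `{0, ∞}` consists of the diagonal and the antidiagonal matrices. -/
theorem mem_stabilizer_zero_inf_iff (g : Matrix.SpecialLinearGroup (Fin 2) F) :
    g ∈ stabilizer (Matrix.SpecialLinearGroup (Fin 2) F)
        ({projPt 0, projInf} : Set (Projectivization F (Fin 2 → F))) ↔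
      (g 1 0 = 0 ∧ g 0 1 = 0) ∨ (g 0 0 = 0 ∧ g 1 1 = 0) := by
  rw [mem_stabilizer_iff, smul_pair, Set.pair_eq_pair_iff, smul_projPt_eq_projPt_iff,
    smul_projPt_eq_projInf_iff, smul_projInf_eq_projPt_iff, smul_projInf_eq_projInf_iff]
  simp

/-- The pair `{u j, u (j + 1)}` of points on the projective line. -/
def scaledPair (j u : F) : Set (Projectivization F (Fin 2 → F)) :=
  {projPt (u * j), projPt (u * (j + 1))}

theorem scaledPair_eq_iff (j u v : F) :
    scaledPair j u = scaledPair j v ↔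
      u = v ∨ (u * j = v * (j + 1) ∧ u * (j + 1) = v * j) := by
  rw [scaledPair, scaledPair, Set.pair_eq_pair_iff, projPt_injective.eq_iff,
    projPt_injective.eq_iff, projPt_injective.eq_iff, projPt_injective.eq_iff]
  refine or_congr_left ⟨fun ⟨h₁, h₂⟩ => by linear_combination h₂ - h₁, ?_⟩
  rintro rfl
  exact ⟨rfl, rfl⟩

section FiniteField

variable [Fintype F]

theorem not_isSquare_neg_one (h3 : Fintype.card F % 4 = 3) : ¬ IsSquare (-1 : F) := by
  rw [FiniteField.isSquare_neg_one_iff]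
  simpa using h3

theorem isSquare_neg_iff_not (h3 : Fintype.card F % 4 = 3) {x : F} (hx : x ≠ 0) :
    IsSquare (-x) ↔ ¬ IsSquare x := by
  classical
  have hF : ringChar F ≠ 2 := fun h => by
    have := FiniteField.even_card_of_char_two h
    omega
  have h1 : quadraticChar F (-1) = -1 :=
    quadraticChar_neg_one_iff_not_isSquare.2 (not_isSquare_neg_one h3)
  rw [← quadraticChar_neg_one_iff_not_isSquare, ← quadraticChar_one_iff_isSquare (neg_ne_zero.2 hx),
    ← neg_one_mul, map_mul, h1]
  constructor <;> intro h <;> linarith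

theorem orbit_eq_image_scaledPair (h3 : Fintype.card F % 4 = 3) (j : F) (hj : j ^ 2 + j ≠ 0) :
    orbit (stabilizer (Matrix.SpecialLinearGroup (Fin 2) F)
        ({projPt 0, projInf} : Set (Projectivization F (Fin 2 → F))))
      ({projPt j, projPt (j + 1)} : Set (Projectivization F (Fin 2 → F))) =
    scaledPair j '' {u | u ≠ 0 ∧ (IsSquare u ∨ ¬ IsSquare (u * (j ^ 2 + j)))} := by
  have hj0 : j ≠ 0 := by rintro rfl; simp at hj
  have hj1 : j + 1 ≠ 0 := fun h => hj (by linear_combination j * h)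
  ext s
  constructor
  · rintro ⟨⟨g, hg⟩, rfl⟩
    change g • ({projPt j, projPt (j + 1)} : Set (Projectivization F (Fin 2 → F))) ∈ _
    have hdet := g.det_coe
    rw [Matrix.det_fin_two] at hdet
    rw [smul_pair]
    rcases (mem_stabilizer_zero_inf_iff g).1 hg with ⟨hc, hb⟩ | ⟨ha, hd⟩
    · rw [hc, hb] at hdet
      have hd0 : g 1 1 ≠ 0 := by intro h; simp [h] at hdet
      refine ⟨g 1 1 * g 1 1, ⟨mul_ne_zero hd0 hd0, .inl ⟨_, rfl⟩⟩, ?_⟩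
      rw [scaledPair, eq_comm,
        (smul_projPt_eq_projPt_iff g j (g 1 1 * g 1 1 * j)).2 ?_,
        (smul_projPt_eq_projPt_iff g (j + 1) (g 1 1 * g 1 1 * (j + 1))).2 ?_]
      · rw [hc, hb]; linear_combination (-(j + 1) * g 1 1) * hdet
      · rw [hc, hb]; linear_combination (-j * g 1 1) * hdet
    · rw [ha, hd] at hdet
      have hc0 : g 1 0 ≠ 0 := by intro h; simp [h] at hdet
      refine ⟨-(g 1 0 * g 1 0) / (j ^ 2 + j), ⟨div_ne_zero (neg_ne_zero.2 (mul_ne_zero hc0 hc0)) hj,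
        .inr ?_⟩, ?_⟩
      · rw [div_mul_cancel₀ _ hj, ← isSquare_neg_iff_not h3 (neg_ne_zero.2 (mul_ne_zero hc0 hc0)),
          neg_neg]
        exact ⟨_, rfl⟩
      · rw [scaledPair, eq_comm, Set.pair_comm,
          (smul_projPt_eq_projPt_iff g j (-(g 1 0 * g 1 0) / (j ^ 2 + j) * (j + 1))).2 ?_,
          (smul_projPt_eq_projPt_iff g (j + 1) (-(g 1 0 * g 1 0) / (j ^ 2 + j) * j)).2 ?_]
        · rw [ha, hd]; field_simp; linear_combination (-(j + 1) * g 1 0) * hdet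
        · rw [ha, hd]; field_simp; linear_combination (-j * g 1 0) * hdet
  · rintro ⟨u, ⟨hu, hsq⟩, rfl⟩
    rcases hsq with ⟨d, rfl⟩ | hsq
    · have hd : d ≠ 0 := by rintro rfl; simp at hu
      obtain ⟨g, hg⟩ : ∃ g : Matrix.SpecialLinearGroup (Fin 2) F, g.1 = !![d⁻¹, 0; 0, d] :=
        ⟨⟨!![d⁻¹, 0; 0, d], by simp [Matrix.det_fin_two, hd]⟩, rfl⟩
      refine ⟨⟨g, (mem_stabilizer_zero_inf_iff g).2 (.inl (by simp [hg]))⟩, ?_⟩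
      change g • ({projPt j, projPt (j + 1)} : Set (Projectivization F (Fin 2 → F))) = _
      rw [smul_pair, scaledPair,
        (smul_projPt_eq_projPt_iff g j (d * d * j)).2 ?_,
        (smul_projPt_eq_projPt_iff g (j + 1) (d * d * (j + 1))).2 ?_] <;>
      · simp [hg]; field_simp
    · obtain ⟨c, hc⟩ := (isSquare_neg_iff_not h3 (mul_ne_zero hu hj)).2 hsq
      have hc0 : c ≠ 0 := by
        rintro rfl
        simp [hu, hj] at hc
      obtain ⟨g, hg⟩ : ∃ g : Matrix.SpecialLinearGroup (Fin 2) F, g.1 = !![0, -c⁻¹; c, 0] :=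
        ⟨⟨!![0, -c⁻¹; c, 0], by simp [Matrix.det_fin_two, hc0]⟩, rfl⟩
      refine ⟨⟨g, (mem_stabilizer_zero_inf_iff g).2 (.inr (by simp [hg]))⟩, ?_⟩
      change g • ({projPt j, projPt (j + 1)} : Set (Projectivization F (Fin 2 → F))) = _
      rw [smul_pair, scaledPair, Set.pair_comm,
        (smul_projPt_eq_projPt_iff g j (u * (j + 1))).2 ?_,
        (smul_projPt_eq_projPt_iff g (j + 1) (u * j)).2 ?_] <;>
      · simp [hg]; field_simp; linear_combination -hc

theorem ncard_ne_zero_eq : {u : F | u ≠ 0}.ncard = Fintype.card F - 1 := by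
  have h : {u : F | u ≠ 0} = ({0} : Set F)ᶜ := rfl
  rw [h, Set.ncard_compl, Set.ncard_singleton, Nat.card_eq_fintype_card]

theorem ncard_ne_zero_isSquare (h3 : Fintype.card F % 4 = 3) :
    {u : F | u ≠ 0 ∧ IsSquare u}.ncard = (Fintype.card F - 1) / 2 := by
  have hneg : {u : F | u ≠ 0 ∧ ¬ IsSquare u} = Neg.neg '' {u : F | u ≠ 0 ∧ IsSquare u} := by
    ext u
    rw [Set.image_neg_eq_neg, Set.mem_neg]
    simp only [Set.mem_ofPred_eq, neg_ne_zero]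
    exact and_congr_right fun hu => (isSquare_neg_iff_not h3 hu).symm
  have hunion : {u : F | u ≠ 0} =
      {u : F | u ≠ 0 ∧ IsSquare u} ∪ {u : F | u ≠ 0 ∧ ¬ IsSquare u} := by
    ext u
    simp only [Set.mem_ofPred_eq, Set.mem_union]
    tauto
  have hdisj : Disjoint {u : F | u ≠ 0 ∧ IsSquare u} {u : F | u ≠ 0 ∧ ¬ IsSquare u} :=
    Set.disjoint_left.2 fun u h h' => h'.2 h.2
  have hcard := ncard_ne_zero_eq (F := F)
  rw [hunion, Set.ncard_union_eq hdisj, hneg, Set.ncard_image_of_injective _ neg_injective] at hcard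
  omega

/-- If `-1` is not a square, then `u ↦ {u j, u (j + 1)}` is injective on the nonzero squares. -/
theorem injOn_scaledPair_isSquare (h3 : Fintype.card F % 4 = 3) (j : F) :
    Set.InjOn (scaledPair j) {u | u ≠ 0 ∧ IsSquare u} := by
  rintro u ⟨hu, hus⟩ v ⟨hv, hvs⟩ h
  rcases (scaledPair_eq_iff j u v).1 h with h | ⟨h₁, h₂⟩
  · exact h
  · have huv : u = -v := by linear_combination h₂ - h₁
    rw [huv, isSquare_neg_iff_not h3 hv] at hus
    exact absurd hvs hus

theorem injective_scaledPair_of_isSquare (h3 : Fintype.card F % 4 = 3) {j : F}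
    (hj : IsSquare (j ^ 2 + j)) : Function.Injective (scaledPair j) := by
  intro u v h
  rcases (scaledPair_eq_iff j u v).1 h with h | ⟨h₁, h₂⟩
  · exact h
  · by_contra hne
    have h0 : 2 * j + 1 = 0 := by
      refine (mul_eq_zero.1 ?_).resolve_left (sub_ne_zero.2 hne)
      linear_combination h₁ + h₂
    obtain ⟨r, hr⟩ := hj
    exact not_isSquare_neg_one h3 ⟨2 * r, by linear_combination 4 * hr - (2 * j + 1) * h0⟩

end FiniteField

/-- Let `q ≡ 3 (mod 4)` and `j ∈ F_q` with `j² + j ≠ 0`. In the action of `PSL(2,q)` on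
unordered pairs of distinct projective points, the orbit of the pair `{j, j+1}` under the
stabilizer `H` of `{0, ∞}` has length `(q-1)/2` if `j² + j` is a non-square, and `q - 1`
if `j² + j` is a (nonzero) square. (Since the center of `SL(2,q)` acts trivially on the
projective line, `H`-orbits coincide with the orbits of the `SL(2,q)`-stabilizer used here.) -/
theorem stmt_9 [Fintype F] [DecidableEq F]
    (h3 : Fintype.card F % 4 = 3) (j : F) (hj : j ^ 2 + j ≠ 0) :
    (¬ IsSquare (j ^ 2 + j) →
      Nat.card (orbit (stabilizer (Matrix.SpecialLinearGroup (Fin 2) F)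
          ({projPt 0, projInf} : Set (Projectivization F (Fin 2 → F))))
        ({projPt j, projPt (j + 1)} : Set (Projectivization F (Fin 2 → F)))) =
        (Fintype.card F - 1) / 2) ∧
    (IsSquare (j ^ 2 + j) →
      Nat.card (orbit (stabilizer (Matrix.SpecialLinearGroup (Fin 2) F)
          ({projPt 0, projInf} : Set (Projectivization F (Fin 2 → F))))
        ({projPt j, projPt (j + 1)} : Set (Projectivization F (Fin 2 → F)))) =
        Fintype.card F - 1) := by
  rw [orbit_eq_image_scaledPair h3 j hj, Nat.card_coe_set_eq]
  constructor
  · intro hns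
    have hset : {u : F | u ≠ 0 ∧ (IsSquare u ∨ ¬ IsSquare (u * (j ^ 2 + j)))} =
        {u | u ≠ 0 ∧ IsSquare u} := by
      ext u
      refine and_congr_right fun hu => or_iff_left_of_imp fun h => ?_
      have hu' : quadraticChar F (u * (j ^ 2 + j)) = -1 :=
        quadraticChar_neg_one_iff_not_isSquare.2 h
      rw [map_mul, quadraticChar_neg_one_iff_not_isSquare.2 hns] at hu'
      exact (quadraticChar_one_iff_isSquare hu).1 (by linarith)
    rw [hset, (injOn_scaledPair_isSquare h3 j).ncard_image, ncard_ne_zero_isSquare h3]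
  · intro hs
    have hset : {u : F | u ≠ 0 ∧ (IsSquare u ∨ ¬ IsSquare (u * (j ^ 2 + j)))} = {u | u ≠ 0} := by
      ext u
      refine and_iff_left_of_imp fun hu => or_iff_not_imp_left.2 fun hns h => hns ?_
      simpa [hj] using h.div hs
    rw [hset, Set.ncard_image_of_injective _ (injective_scaledPair_of_isSquare h3 hs),
      ncard_ne_zero_eq]
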